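/- Let α be a real number with 0 < α < 1 and let τ₀ > 0. Then the function s ↦ E_α(−(s/τ₀)^α) belongs to L²([0, ∞)), i.e. ∫_0^∞ (E_α(−(s/τ₀)^α))² ds < ∞, if and only if α > 1/2. -/

import Mathlib

/-- The two-parameter Mittag-Leffler function `E_{α,β}(x) = ∑ x ^ k / Γ(α k + β)`
for real `x`. The classical Mittag-Leffler function is `E_α = E_{α,1}`. -/
noncomputable def mittagLeffler (α β : ℝ) (x : ℝ) : ℝ :=
  ∑' k : ℕ, x ^ k / Real.Gamma (α * k + β)

open Set MeasureTheory Filter Topology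

theorem rpow_mul_exp_neg_le_Gamma {R x : ℝ} (hR : 0 < R) (hx : 1 ≤ x) :
    R ^ (x - 1) * Real.exp (-R) ≤ Real.Gamma x := by
  have hint := Real.GammaIntegral_convergent (zero_lt_one.trans_le hx)
  rw [Real.Gamma_eq_integral (zero_lt_one.trans_le hx)]
  calc R ^ (x - 1) * Real.exp (-R) = ∫ t in Ioi R, Real.exp (-t) * R ^ (x - 1) := by
        rw [integral_mul_const, integral_exp_neg_Ioi, mul_comm]
    _ ≤ ∫ t in Ioi R, Real.exp (-t) * t ^ (x - 1) := by
        refine setIntegral_mono_on ((integrableOn_exp_neg_Ioi R).mul_const _)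
          (hint.mono_set (Ioi_subset_Ioi hR.le)) measurableSet_Ioi fun t ht => ?_
        have : R ≤ t := le_of_lt ht
        have : 0 ≤ x - 1 := by linarith
        gcongr
    _ ≤ ∫ t in Ioi 0, Real.exp (-t) * t ^ (x - 1) := by
        refine setIntegral_mono_set hint ?_ (Ioi_subset_Ioi hR.le).eventuallyLE
        filter_upwards [ae_restrict_mem measurableSet_Ioi] with t ht
        have : (0 : ℝ) < t := ht
        positivity

theorem summable_pow_div_Gamma {α : ℝ} (hα : 0 < α) (β x : ℝ) :
    Summable fun k : ℕ => x ^ k / Real.Gamma (α * k + β) := by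
  obtain ⟨R, hR0, hR⟩ : ∃ R : ℝ, 0 < R ∧ R ^ α = 2 * (|x| + 1) := by
    refine ⟨(2 * (|x| + 1)) ^ α⁻¹, by positivity, ?_⟩
    rw [← Real.rpow_mul (by positivity), inv_mul_cancel₀ hα.ne', Real.rpow_one]
  have hev : ∀ᶠ k : ℕ in atTop, 1 ≤ α * k + β := by
    have : Tendsto (fun k : ℕ => α * (k : ℝ) + β) atTop atTop :=
      tendsto_atTop_add_const_right _ _ (tendsto_natCast_atTop_atTop.const_mul_atTop hα)
    exact this.eventually_ge_atTop 1
  refine Summable.of_norm_bounded_eventually_nat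
    (g := fun k : ℕ => (Real.exp R * R ^ (1 - β)) * (1 / 2) ^ k)
    (summable_geometric_two.mul_left _) ?_
  filter_upwards [hev] with k hk
  have hG := rpow_mul_exp_neg_le_Gamma hR0 hk
  have hGp : 0 < Real.Gamma (α * k + β) := Real.Gamma_pos_of_pos (by linarith)
  rw [norm_div, norm_pow, Real.norm_eq_abs, Real.norm_of_nonneg hGp.le, div_le_iff₀ hGp]
  have hRk : R ^ (α * k + β - 1) = (2 * (|x| + 1)) ^ k * R ^ (β - 1) := by
    rw [add_sub_assoc, Real.rpow_add hR0, Real.rpow_mul hR0.le, hR, Real.rpow_natCast]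
  have hinv : R ^ (1 - β) * R ^ (β - 1) = 1 := by
    rw [← Real.rpow_add hR0]; simp
  have hexp : Real.exp R * Real.exp (-R) = 1 := by rw [← Real.exp_add]; simp
  calc |x| ^ k ≤ (|x| + 1) ^ k := by gcongr; linarith
    _ = (Real.exp R * Real.exp (-R)) * (R ^ (1 - β) * R ^ (β - 1)) *
          ((1 / 2) * (2 * (|x| + 1))) ^ k := by rw [hinv, hexp]; ring
    _ = (Real.exp R * R ^ (1 - β)) * (1 / 2) ^ k * (R ^ (α * k + β - 1) * Real.exp (-R)) := by
        rw [hRk, mul_pow]; ring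
    _ ≤ _ := by gcongr

theorem differentiable_mittagLeffler {α β : ℝ} (hα : 0 < α) (hβ : 0 < β) :
    Differentiable ℝ (mittagLeffler α β) := by
  set c : ℕ → ℝ := fun k => (Real.Gamma (α * k + β))⁻¹
  have hrad : (FormalMultilinearSeries.ofScalars ℝ c).radius = ⊤ := by
    refine FormalMultilinearSeries.radius_eq_top_of_summable_norm _ fun r => ?_
    refine (summable_pow_div_Gamma hα β r).congr fun k => ?_
    have : 0 < Real.Gamma (α * k + β) := Real.Gamma_pos_of_pos (by positivity)
    rw [FormalMultilinearSeries.ofScalars_norm, Real.norm_of_nonneg (inv_nonneg.2 this.le),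
      div_eq_mul_inv, mul_comm]
  have h := (FormalMultilinearSeries.ofScalars ℝ c).hasFPowerSeriesOnBall (by simp [hrad])
  have heq : (FormalMultilinearSeries.ofScalars ℝ c).sum = mittagLeffler α β := by
    ext x
    refine (FormalMultilinearSeries.ofScalars_sum_eq c x).trans (tsum_congr fun k => ?_)
    simp only [c, smul_eq_mul]
    ring
  rw [heq, hrad] at h
  intro x
  exact h.differentiableOn.differentiableAt (by simp)

theorem mittagLeffler_zero (α β : ℝ) : mittagLeffler α β 0 = (Real.Gamma β)⁻¹ := by
  rw [mittagLeffler, tsum_eq_single 0 (fun k hk => by simp [hk])]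
  simp

theorem mittagLeffler_eq_add {α : ℝ} (hα : 0 < α) (β x : ℝ) :
    mittagLeffler α β x = (Real.Gamma β)⁻¹ + x * mittagLeffler α (α + β) x := by
  rw [mittagLeffler, (summable_pow_div_Gamma hα β x).tsum_eq_zero_add, mittagLeffler,
    ← tsum_mul_left]
  simp only [pow_zero, CharP.cast_eq_zero, mul_zero, zero_add, one_div]
  congr 1
  refine tsum_congr fun k => ?_
  rw [pow_succ', mul_div_assoc]
  push_cast
  ring_nf

theorem continuous_mittagLeffler_neg_rpow {α β : ℝ} (hα : 0 < α) (hβ : 0 < β) :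
    Continuous fun s : ℝ => mittagLeffler α β (-(s ^ α)) :=
  (differentiable_mittagLeffler hα hβ).continuous.comp
    (Real.continuous_rpow_const hα.le).neg

theorem integral_rpow_mul_sub_rpow {b c T : ℝ} (hb : 0 < b) (hc : 0 < c) (hT : 0 < T) :
    ∫ s in 0..T, (T - s) ^ (b - 1) * s ^ (c - 1) =
      Real.Gamma b * (T ^ (b + c - 1) * (Real.Gamma c / Real.Gamma (b + c))) := by
  have h := Complex.betaIntegral_scaled (c : ℂ) (b : ℂ) hT
  rw [Complex.betaIntegral_eq_Gamma_mul_div _ _ (by simpa) (by simpa)] at h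
  apply Complex.ofReal_injective
  rw [← intervalIntegral.integral_ofReal]
  convert h using 1
  · refine intervalIntegral.integral_congr fun s hs => ?_
    rw [uIcc_of_le hT.le] at hs
    simp only [Complex.ofReal_mul]
    rw [Complex.ofReal_cpow hs.1, Complex.ofReal_cpow (sub_nonneg.2 hs.2)]
    push_cast
    ring
  · push_cast
    rw [Complex.ofReal_cpow hT.le, Complex.Gamma_ofReal, Complex.Gamma_ofReal,
      ← Complex.ofReal_add c b, Complex.Gamma_ofReal, add_comm b c]
    push_cast
    ring

theorem intervalIntegrable_rpow_mul_sub_rpow {b c T : ℝ} (hb : 0 < b) (hc : 0 < c)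
    (hT : 0 < T) :
    IntervalIntegrable (fun s : ℝ => (T - s) ^ (b - 1) * s ^ (c - 1)) volume 0 T := by
  refine intervalIntegral.intervalIntegrable_of_integral_ne_zero ?_
  rw [integral_rpow_mul_sub_rpow hb hc hT]
  have := Real.Gamma_pos_of_pos hb
  have := Real.Gamma_pos_of_pos hc
  have := Real.Gamma_pos_of_pos (add_pos hb hc)
  positivity

theorem intervalIntegrable_sub_rpow_mul_mittagLeffler {α b c T : ℝ} (hα : 0 < α) (hb : 0 < b)
    (hc : 0 < c) (hT : 0 < T) :
    IntervalIntegrable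
      (fun s : ℝ => (T - s) ^ (b - 1) * (s ^ (c - 1) * mittagLeffler α c (-(s ^ α))))
      volume 0 T := by
  simp_rw [← mul_assoc]
  exact (intervalIntegrable_rpow_mul_sub_rpow hb hc hT).mul_continuousOn
    (continuous_mittagLeffler_neg_rpow hα hc).continuousOn

/-- The Riemann-Liouville fractional integral of order `b` of `s ^ (c - 1) * E_{α,c}(-s ^ α)`. -/
theorem integral_sub_rpow_mul_mittagLeffler {α b c T : ℝ} (hα : 0 < α) (hb : 0 < b)
    (hc : 0 < c) (hT : 0 < T) :
    ∫ s in 0..T, (T - s) ^ (b - 1) * (s ^ (c - 1) * mittagLeffler α c (-(s ^ α))) =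
      Real.Gamma b * (T ^ (b + c - 1) * mittagLeffler α (b + c) (-(T ^ α))) := by
  have hck (k : ℕ) : 0 < α * k + c := by positivity
  have hΓ (k : ℕ) : 0 < Real.Gamma (α * k + c) := Real.Gamma_pos_of_pos (hck k)
  set G : ℕ → ℝ → ℝ := fun k s => (T - s) ^ (b - 1) * s ^ (α * k + c - 1)
  set a : ℕ → ℝ := fun k => (-1) ^ k / Real.Gamma (α * k + c)
  have hrp {s : ℝ} (hs : 0 < s) (d : ℝ) (k : ℕ) :
      s ^ (α * k + d - 1) = s ^ (d - 1) * (s ^ α) ^ k := by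
    rw [← Real.rpow_natCast, ← Real.rpow_mul hs.le, ← Real.rpow_add hs]
    ring_nf
  have hGint (k : ℕ) : ∫ s in Ioc 0 T, G k s = Real.Gamma b * T ^ (b + c - 1) *
      Real.Gamma (α * k + c) * ((T ^ α) ^ k / Real.Gamma (α * k + (b + c))) := by
    rw [← intervalIntegral.integral_of_le hT.le, integral_rpow_mul_sub_rpow hb (hck k) hT,
      show b + (α * k + c) = α * k + (b + c) by ring, hrp hT]
    ring
  have hGi (k : ℕ) : Integrable (G k) (volume.restrict (Ioc 0 T)) :=
    (intervalIntegrable_iff_integrableOn_Ioc_of_le hT.le).1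
      (intervalIntegrable_rpow_mul_sub_rpow hb (hck k) hT)
  have hG0 (k : ℕ) : ∀ᵐ s ∂(volume.restrict (Ioc 0 T)), ‖a k * G k s‖ =
      (Real.Gamma (α * k + c))⁻¹ * G k s := by
    filter_upwards [ae_restrict_mem measurableSet_Ioc] with s hs
    have h1 : 0 ≤ G k s :=
      mul_nonneg (Real.rpow_nonneg (sub_nonneg.2 hs.2) _) (Real.rpow_nonneg hs.1.le _)
    rw [norm_mul, Real.norm_of_nonneg h1]
    simp [a, abs_of_pos (hΓ k)]
  have hsum : Summable fun k => ∫ s in Ioc 0 T, ‖a k * G k s‖ := by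
    refine ((summable_pow_div_Gamma hα (b + c) (T ^ α)).mul_left
      (Real.Gamma b * T ^ (b + c - 1))).congr fun k => ?_
    rw [integral_congr_ae (hG0 k), integral_const_mul, hGint]
    have := (hΓ k).ne'
    field_simp
  have key := hasSum_integral_of_summable_integral_norm (fun k => (hGi k).const_mul (a k)) hsum
  rw [intervalIntegral.integral_of_le hT.le]
  calc _ = ∫ s in Ioc 0 T, ∑' k, a k * G k s := by
        refine setIntegral_congr_fun measurableSet_Ioc fun s hs => ?_
        simp only [mittagLeffler]
        rw [← mul_assoc, ← tsum_mul_left]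
        refine tsum_congr fun k => ?_
        simp only [a, G]
        rw [hrp hs.1, neg_pow]
        ring
    _ = ∑' k, ∫ s in Ioc 0 T, a k * G k s := key.tsum_eq.symm
    _ = _ := by
        rw [mittagLeffler, ← mul_assoc, ← tsum_mul_left]
        refine tsum_congr fun k => ?_
        rw [integral_const_mul, hGint, neg_pow (T ^ α)]
        simp only [a]
        have := (hΓ k).ne'
        field_simp

theorem integral_rpow_mul_mittagLeffler_self {α T : ℝ} (hα : 0 < α) (hT : 0 < T) :
    ∫ s in 0..T, s ^ (α - 1) * mittagLeffler α α (-(s ^ α)) =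
      1 - mittagLeffler α 1 (-(T ^ α)) := by
  have h := integral_sub_rpow_mul_mittagLeffler hα one_pos hα hT
  simp only [sub_self, Real.rpow_zero, one_mul, Real.Gamma_one, add_sub_cancel_left] at h
  rw [h, mittagLeffler_eq_add hα 1 (-(T ^ α)), Real.Gamma_one, add_comm α 1]
  ring

theorem intervalIntegrable_rpow_mul_mittagLeffler_self {α T : ℝ} (hα : 0 < α) (hT : 0 < T) :
    IntervalIntegrable (fun s : ℝ => s ^ (α - 1) * mittagLeffler α α (-(s ^ α))) volume 0 T := by
  simpa using intervalIntegrable_sub_rpow_mul_mittagLeffler hα one_pos hα hT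

theorem integral_sub_rpow_neg_mul_mittagLeffler_self {α T : ℝ} (hα : 0 < α) (hα1 : α < 1)
    (hT : 0 < T) :
    ∫ s in 0..T, (T - s) ^ (-α) * (s ^ (α - 1) * mittagLeffler α α (-(s ^ α))) =
      Real.Gamma (1 - α) * mittagLeffler α 1 (-(T ^ α)) := by
  have h := integral_sub_rpow_mul_mittagLeffler hα (sub_pos.2 hα1) hα hT
  simpa using h

theorem intervalIntegrable_sub_rpow_neg_mul_mittagLeffler_self {α T : ℝ} (hα : 0 < α)
    (hα1 : α < 1) (hT : 0 < T) :
    IntervalIntegrable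
      (fun s : ℝ => (T - s) ^ (-α) * (s ^ (α - 1) * mittagLeffler α α (-(s ^ α)))) volume 0 T := by
  simpa using intervalIntegrable_sub_rpow_mul_mittagLeffler hα (sub_pos.2 hα1) hα hT

theorem mul_rpow_le_rpow_neg_sub_rpow_neg {α a b : ℝ} (hα : 0 < α) (hα1 : α < 1) (ha : 0 < a)
    (hab : a ≤ b) : α * (b - a) * b ^ (-α - 1) ≤ a ^ (-α) - b ^ (-α) := by
  have hb : 0 < b := ha.trans_le hab
  set x := (b - a) / b
  have hx0 : 0 ≤ x := div_nonneg (sub_nonneg.2 hab) hb.le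
  have hx1 : x < 1 := (div_lt_one hb).2 (by linarith)
  have hax : a = b * (1 + -x) := by simp only [x]; field_simp; ring
  have hB := rpow_one_add_le_one_add_mul_self (s := -x) (by linarith) hα.le hα1.le
  have hpos : 0 < (1 + -x) ^ α := Real.rpow_pos_of_pos (by linarith) _
  have hinv : 1 + α * x ≤ (1 + -x) ^ (-α) := by
    rw [Real.rpow_neg (by linarith), ← one_div, le_div_iff₀ hpos]
    calc (1 + α * x) * (1 + -x) ^ α ≤ (1 + α * x) * (1 + α * -x) := by gcongr
      _ ≤ 1 := by nlinarith [sq_nonneg (α * x)]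
  have hbx : α * (b - a) * b ^ (-α - 1) = b ^ (-α) * (α * x) := by
    rw [Real.rpow_sub_one hb.ne']; simp only [x]; ring
  rw [hbx]
  conv_rhs => rw [hax, Real.mul_rpow hb.le (by linarith)]
  nlinarith [Real.rpow_pos_of_pos hb (-α)]

/-- `E_{α,α}(-s ^ α)` has no first zero: at such a point the derivative of `E_α(-s ^ α)` vanishes,
while the Caputo formula for it forces a strictly negative value of the fractional integral's
left derivative. -/
theorem mittagLeffler_self_pos_of_forall_lt {α t₀ : ℝ} (hα : 0 < α) (hα1 : α < 1) (ht₀ : 0 < t₀)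
    (hlt : ∀ s, 0 < s → s < t₀ → 0 < mittagLeffler α α (-(s ^ α))) :
    0 < mittagLeffler α α (-(t₀ ^ α)) := by
  by_contra! hneg
  set k : ℝ → ℝ := fun s => s ^ (α - 1) * mittagLeffler α α (-(s ^ α)) with hk
  have hkpos (s : ℝ) (hs : 0 < s) (hs' : s < t₀) : 0 < k s :=
    mul_pos (Real.rpow_pos_of_pos hs _) (hlt s hs hs')
  have hkt₀ : k t₀ ≤ 0 := mul_nonpos_of_nonneg_of_nonpos (by positivity) hneg
  have hki {u : ℝ} (hu : 0 < u) : IntervalIntegrable k volume 0 u :=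
    intervalIntegrable_rpow_mul_mittagLeffler_self hα hu
  have hKi {u : ℝ} (hu : 0 < u) : IntervalIntegrable (fun s => (u - s) ^ (-α) * k s) volume 0 u :=
    intervalIntegrable_sub_rpow_neg_mul_mittagLeffler_self hα hα1 hu
  have hdiff : DifferentiableAt ℝ k t₀ := by
    refine DifferentiableAt.mul (Real.differentiableAt_rpow_const_of_ne _ ht₀.ne') ?_
    exact (differentiable_mittagLeffler hα hα).differentiableAt.comp t₀
      (Real.differentiableAt_rpow_const_of_ne _ ht₀.ne').neg
  obtain ⟨M, hM0, hM⟩ := hdiff.isBigO_sub.exists_pos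
  obtain ⟨η, hη0, hη⟩ := Metric.eventually_nhds_iff.1 hM.bound
  have hkle {s : ℝ} (hs : s ≤ t₀) (hs' : t₀ - s < η) : k s ≤ M * (t₀ - s) := by
    have h := hη (y := s) (by
      rwa [Real.dist_eq, abs_sub_comm, abs_of_nonneg (by linarith)])
    rw [Real.norm_eq_abs, Real.norm_eq_abs, abs_sub_comm s t₀,
      abs_of_nonneg (sub_nonneg.2 hs)] at h
    linarith [le_abs_self (k s - k t₀)]
  set c : ℝ := α * t₀ ^ (-α - 1) * ∫ s in 0..(t₀ / 2), k s
  have hc : 0 < c := by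
    refine mul_pos (by positivity) (intervalIntegral.intervalIntegral_pos_of_pos_on
      (hki (by linarith)) (fun s hs => hkpos s hs.1 (by linarith [hs.2])) (by linarith))
  have hΓ : 0 < Real.Gamma (1 - α) := Real.Gamma_pos_of_pos (by linarith)
  have main (δ : ℝ) (hδ0 : 0 < δ) (hδη : δ < η) (hδt : δ < t₀ / 2) :
      c ≤ Real.Gamma (1 - α) * (M * δ) + M * δ ^ (1 - α) := by
    obtain ⟨u, hu⟩ : ∃ u, u = t₀ - δ := ⟨_, rfl⟩
    have hu0 : 0 < u := by linarith
    have hut : u ≤ t₀ := by linarith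
    have hsub : uIcc u t₀ ⊆ uIcc 0 t₀ := by
      rw [uIcc_of_le hut, uIcc_of_le ht₀.le]; exact Icc_subset_Icc_left hu0.le
    have hsub' : uIcc 0 u ⊆ uIcc 0 t₀ := by
      rw [uIcc_of_le hu0.le, uIcc_of_le ht₀.le]; exact Icc_subset_Icc_right hut
    have hki2 := (hki ht₀).mono_set hsub
    have hKi1 := (hKi ht₀).mono_set hsub'
    have hKi2 := (hKi ht₀).mono_set hsub
    have e1 := integral_sub_rpow_neg_mul_mittagLeffler_self hα hα1 ht₀
    have e2 := integral_sub_rpow_neg_mul_mittagLeffler_self hα hα1 hu0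
    have e3 := integral_rpow_mul_mittagLeffler_self hα ht₀
    have e4 := integral_rpow_mul_mittagLeffler_self hα hu0
    have s1 := intervalIntegral.integral_add_adjacent_intervals hKi1 hKi2
    have s2 := intervalIntegral.integral_add_adjacent_intervals (hki hu0) hki2
    have b1 : ∫ s in u..t₀, k s ≤ M * δ * δ := by
      calc ∫ s in u..t₀, k s ≤ ∫ s in u..t₀, M * δ := by
            refine intervalIntegral.integral_mono_on hut hki2 (by simp) fun s hs => ?_
            refine (hkle hs.2 (by linarith [hs.1])).trans ?_
            gcongr
            linarith [hs.1]
        _ = M * δ * δ := by rw [intervalIntegral.integral_const, smul_eq_mul, hu]; ring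
    have b2 : ∫ s in u..t₀, (t₀ - s) ^ (-α) * k s ≤ M * δ ^ (1 - α) * δ := by
      calc ∫ s in u..t₀, (t₀ - s) ^ (-α) * k s ≤ ∫ s in u..t₀, M * δ ^ (1 - α) := by
            refine intervalIntegral.integral_mono_on_of_le_Ioo hut hKi2 (by simp) fun s hs => ?_
            have hs0 : 0 < t₀ - s := sub_pos.2 hs.2
            calc (t₀ - s) ^ (-α) * k s ≤ (t₀ - s) ^ (-α) * (M * (t₀ - s)) := by
                  gcongr
                  exact hkle hs.2.le (by linarith [hs.1])
              _ = M * (t₀ - s) ^ (1 - α) := by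
                  rw [show 1 - α = -α + 1 by ring, Real.rpow_add_one hs0.ne']; ring
              _ ≤ M * δ ^ (1 - α) := by
                  have : t₀ - s ≤ δ := by linarith [hs.1]
                  have : 0 ≤ 1 - α := by linarith
                  gcongr
        _ = M * δ ^ (1 - α) * δ := by
            rw [intervalIntegral.integral_const, smul_eq_mul, hu]; ring
    have b3 : c * δ ≤ (∫ s in 0..u, (u - s) ^ (-α) * k s) - ∫ s in 0..u, (t₀ - s) ^ (-α) * k s := by
      rw [← intervalIntegral.integral_sub (hKi hu0) hKi1]
      calc c * δ = α * δ * t₀ ^ (-α - 1) * ∫ s in 0..(t₀ / 2), k s := by simp only [c]; ring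
        _ ≤ α * δ * t₀ ^ (-α - 1) * ∫ s in 0..u, k s := by
            gcongr
            refine intervalIntegral.integral_mono_interval le_rfl (by linarith) (by linarith) ?_
              (hki hu0)
            filter_upwards [ae_restrict_mem measurableSet_Ioc] with s hs
            exact (hkpos s hs.1 (by linarith [hs.2])).le
        _ = ∫ s in 0..u, α * δ * t₀ ^ (-α - 1) * k s :=
            (intervalIntegral.integral_const_mul _ _).symm
        _ ≤ _ := by
            refine intervalIntegral.integral_mono_on_of_le_Ioo hu0.le ((hki hu0).const_mul _)
              ((hKi hu0).sub hKi1) fun s hs => ?_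
            rw [← sub_mul]
            have hkp := (hkpos s hs.1 (by linarith [hs.2])).le
            refine mul_le_mul_of_nonneg_right ?_ hkp
            have h := mul_rpow_le_rpow_neg_sub_rpow_neg (a := u - s) (b := t₀ - s) hα hα1
              (by linarith [hs.2]) (by linarith)
            refine le_trans ?_ h
            have hd : t₀ - s - (u - s) = δ := by linarith
            rw [hd]
            have hts : 0 < t₀ - s := by linarith [hs.2]
            have : t₀ ^ (-α - 1) ≤ (t₀ - s) ^ (-α - 1) :=
              Real.rpow_le_rpow_of_nonpos hts (by linarith [hs.1]) (by linarith)
            gcongr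
    have hfin : c * δ ≤ (Real.Gamma (1 - α) * (M * δ) + M * δ ^ (1 - α)) * δ := by
      simp only [hk] at s1 s2 b1 b2 b3
      nlinarith
    exact le_of_mul_le_mul_right hfin hδ0
  have htend : Tendsto (fun δ : ℝ => Real.Gamma (1 - α) * (M * δ) + M * δ ^ (1 - α)) (𝓝[>] 0)
      (𝓝 0) := by
    have hcont : Continuous fun δ : ℝ => Real.Gamma (1 - α) * (M * δ) + M * δ ^ (1 - α) := by
      have := Real.continuous_rpow_const (q := 1 - α) (by linarith)
      fun_prop
    have h0 := hcont.tendsto 0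
    rw [Real.zero_rpow (by linarith)] at h0
    simp only [mul_zero, add_zero] at h0
    exact h0.mono_left nhdsWithin_le_nhds
  refine absurd (ge_of_tendsto htend ?_) (not_le.2 hc)
  filter_upwards [Ioo_mem_nhdsGT (lt_min hη0 (half_pos ht₀))] with δ hδ
  exact main δ hδ.1 (hδ.2.trans_le (min_le_left _ _)) (hδ.2.trans_le (min_le_right _ _))

theorem mittagLeffler_self_neg_rpow_pos {α t : ℝ} (hα : 0 < α) (hα1 : α < 1) (ht : 0 ≤ t) :
    0 < mittagLeffler α α (-(t ^ α)) := by
  by_contra! hneg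
  have hcl : IsCompact {s ∈ Icc 0 t | mittagLeffler α α (-(s ^ α)) ≤ 0} :=
    isCompact_Icc.inter_right
      (isClosed_le (continuous_mittagLeffler_neg_rpow hα hα) continuous_const)
  obtain ⟨t₀, ⟨⟨h0, h1⟩, h2⟩, hmin⟩ := hcl.exists_isLeast ⟨t, ⟨ht, le_rfl⟩, hneg⟩
  rcases h0.eq_or_lt with rfl | h0
  · rw [Real.zero_rpow hα.ne', neg_zero, mittagLeffler_zero] at h2
    exact absurd h2 (not_le.2 (inv_pos.2 (Real.Gamma_pos_of_pos hα)))
  · refine absurd h2 (not_le.2 (mittagLeffler_self_pos_of_forall_lt hα hα1 h0 fun s hs hst => ?_))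
    by_contra! hs'
    exact absurd (hmin ⟨⟨hs.le, hst.le.trans h1⟩, hs'⟩) (not_le.2 hst)

theorem rpow_mul_mittagLeffler_self_nonneg {α s : ℝ} (hα : 0 < α) (hα1 : α < 1) (hs : 0 ≤ s) :
    0 ≤ s ^ (α - 1) * mittagLeffler α α (-(s ^ α)) :=
  mul_nonneg (Real.rpow_nonneg hs _) (mittagLeffler_self_neg_rpow_pos hα hα1 hs).le

theorem mittagLeffler_one_neg_rpow_nonneg {α t : ℝ} (hα : 0 < α) (hα1 : α < 1) (ht : 0 < t) :
    0 ≤ mittagLeffler α 1 (-(t ^ α)) := by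
  have hΓ : 0 < Real.Gamma (1 - α) := Real.Gamma_pos_of_pos (by linarith)
  refine nonneg_of_mul_nonneg_right ?_ hΓ
  rw [← integral_sub_rpow_neg_mul_mittagLeffler_self hα hα1 ht]
  exact intervalIntegral.integral_nonneg ht.le fun s hs =>
    mul_nonneg (Real.rpow_nonneg (sub_nonneg.2 hs.2) _)
      (rpow_mul_mittagLeffler_self_nonneg hα hα1 hs.1)

theorem antitoneOn_mittagLeffler_one_neg_rpow {α : ℝ} (hα : 0 < α) (hα1 : α < 1) :
    AntitoneOn (fun t : ℝ => mittagLeffler α 1 (-(t ^ α))) (Ioi 0) := by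
  intro u hu t ht hut
  have h1 := integral_rpow_mul_mittagLeffler_self hα hu
  have h2 := integral_rpow_mul_mittagLeffler_self hα ht
  have h3 : ∫ s in 0..u, s ^ (α - 1) * mittagLeffler α α (-(s ^ α)) ≤
      ∫ s in 0..t, s ^ (α - 1) * mittagLeffler α α (-(s ^ α)) := by
    refine intervalIntegral.integral_mono_interval le_rfl (le_of_lt hu) hut ?_
      (intervalIntegrable_rpow_mul_mittagLeffler_self hα ht)
    filter_upwards [ae_restrict_mem measurableSet_Ioc] with s hs
    exact rpow_mul_mittagLeffler_self_nonneg hα hα1 hs.1.le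
  simp only
  linarith

theorem rpow_neg_mul_le_mittagLeffler_one {α t : ℝ} (hα : 0 < α) (hα1 : α < 1) (ht : 1 ≤ t) :
    (Real.Gamma (1 - α) + 1)⁻¹ * t ^ (-α) ≤ mittagLeffler α 1 (-(t ^ α)) := by
  have ht0 : 0 < t := by linarith
  have hΓ : 0 < Real.Gamma (1 - α) := Real.Gamma_pos_of_pos (by linarith)
  have h : t ^ (-α) * (1 - mittagLeffler α 1 (-(t ^ α))) ≤
      Real.Gamma (1 - α) * mittagLeffler α 1 (-(t ^ α)) := by
    rw [← integral_sub_rpow_neg_mul_mittagLeffler_self hα hα1 ht0,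
      ← integral_rpow_mul_mittagLeffler_self hα ht0, ← intervalIntegral.integral_const_mul]
    refine intervalIntegral.integral_mono_on_of_le_Ioo ht0.le
      ((intervalIntegrable_rpow_mul_mittagLeffler_self hα ht0).const_mul _)
      (intervalIntegrable_sub_rpow_neg_mul_mittagLeffler_self hα hα1 ht0) fun s hs => ?_
    exact mul_le_mul_of_nonneg_right
      (Real.rpow_le_rpow_of_nonpos (sub_pos.2 hs.2) (by linarith [hs.1]) (by linarith))
      (rpow_mul_mittagLeffler_self_nonneg hα hα1 hs.1.le)
  have h1 : t ^ (-α) ≤ 1 := Real.rpow_le_one_of_one_le_of_nonpos ht (by linarith)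
  rw [inv_mul_le_iff₀ (by linarith)]
  nlinarith [mittagLeffler_one_neg_rpow_nonneg hα hα1 ht0]

theorem mittagLeffler_one_le_mul_rpow_neg {α t : ℝ} (hα : 0 < α) (hα1 : α < 1) (ht : 0 < t) :
    mittagLeffler α 1 (-(t ^ α)) ≤ (Real.Gamma (2 - α))⁻¹ * t ^ (-α) := by
  have hΓ : 0 < Real.Gamma (2 - α) := Real.Gamma_pos_of_pos (by linarith)
  have hf0 := mittagLeffler_one_neg_rpow_nonneg hα hα1 ht
  have e1 := integral_sub_rpow_mul_mittagLeffler hα one_pos one_pos ht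
  have e2 := integral_sub_rpow_mul_mittagLeffler hα (b := 2 - α) (by linarith) hα ht
  have i2 := intervalIntegrable_sub_rpow_mul_mittagLeffler hα (b := 2 - α) (by linarith) hα ht
  have e3 := integral_rpow_mul_mittagLeffler_self hα ht
  have i3 := intervalIntegrable_rpow_mul_mittagLeffler_self hα ht
  have hf : Continuous fun s : ℝ => mittagLeffler α 1 (-(s ^ α)) :=
    continuous_mittagLeffler_neg_rpow hα one_pos
  simp only [sub_self, Real.rpow_zero, one_mul, Real.Gamma_one, add_sub_cancel_right,
    Real.rpow_one, sub_add_cancel] at e1 e2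
  have lower : t * mittagLeffler α 1 (-(t ^ α)) ≤ t * mittagLeffler α (1 + 1) (-(t ^ α)) := by
    rw [← e1]
    calc _ = ∫ s in 0..t, mittagLeffler α 1 (-(t ^ α)) := by simp
      _ ≤ _ := intervalIntegral.integral_mono_on_of_le_Ioo ht.le (by simp)
          (hf.intervalIntegrable _ _) fun s hs =>
            antitoneOn_mittagLeffler_one_neg_rpow hα hα1 hs.1 ht hs.2.le
  have upper : Real.Gamma (2 - α) * (t * mittagLeffler α 2 (-(t ^ α))) ≤ t ^ (1 - α) := by
    have h21 : (2 : ℝ) - 1 = 1 := by norm_num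
    rw [h21, Real.rpow_one] at e2
    rw [← e2]
    calc _ ≤ ∫ s in 0..t, t ^ (1 - α) * (s ^ (α - 1) * mittagLeffler α α (-(s ^ α))) := by
          refine intervalIntegral.integral_mono_on_of_le_Ioo ht.le i2 (i3.const_mul _)
            fun s hs => ?_
          refine mul_le_mul_of_nonneg_right ?_ (rpow_mul_mittagLeffler_self_nonneg hα hα1 hs.1.le)
          rw [show 2 - α - 1 = 1 - α by ring]
          exact Real.rpow_le_rpow (by linarith [hs.2]) (by linarith [hs.1]) (by linarith)
      _ = t ^ (1 - α) * (1 - mittagLeffler α 1 (-(t ^ α))) := by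
          rw [intervalIntegral.integral_const_mul, e3]
      _ ≤ t ^ (1 - α) := mul_le_of_le_one_right (by positivity) (by linarith)
  rw [one_add_one_eq_two] at lower
  have ht1 : t ^ (1 - α) = t * t ^ (-α) := by
    rw [sub_eq_add_neg, Real.rpow_add ht, Real.rpow_one]
  rw [le_inv_mul_iff₀ hΓ]
  refine le_of_mul_le_mul_left ?_ ht
  nlinarith

/-- Let `0 < α < 1` and `τ₀ > 0`. Then `s ↦ E_α(-(s/τ₀)^α)` belongs to
`L²([0,∞))`, i.e. `∫_0^∞ (E_α(-(s/τ₀)^α))² ds < ∞`, if and only if `α > 1/2`. -/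
theorem mittagLeffler_memL2_iff (α τ₀ : ℝ) (hα : 0 < α) (hα1 : α < 1) (hτ : 0 < τ₀) :
    MeasureTheory.IntegrableOn
      (fun s : ℝ => (mittagLeffler α 1 (-((s / τ₀) ^ α))) ^ 2) (Set.Ici 0)
    ↔ 1 / 2 < α := by
  have hcont : Continuous fun t : ℝ => (mittagLeffler α 1 (-(t ^ α))) ^ 2 :=
    (continuous_mittagLeffler_neg_rpow hα one_pos).pow 2
  have hsq {t : ℝ} (ht : 0 < t) (C : ℝ) : (C * t ^ (-α)) ^ 2 = C ^ 2 * t ^ (-(2 * α)) := by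
    rw [mul_pow, ← Real.rpow_natCast (t ^ (-α)), ← Real.rpow_mul ht.le]
    push_cast
    ring_nf
  have hscale := integrableOn_Ioi_comp_mul_right_iff
    (fun t : ℝ => (mittagLeffler α 1 (-(t ^ α))) ^ 2) 0 (inv_pos.2 hτ)
  rw [integrableOn_Ici_iff_integrableOn_Ioi]
  simp only [← div_eq_mul_inv, zero_div] at hscale
  rw [hscale, ← Ioc_union_Ioi_eq_Ioi (zero_le_one' ℝ), integrableOn_union,
    and_iff_right (hcont.integrableOn_Ioc)]
  have hpow : IntegrableOn (fun t : ℝ => t ^ (-(2 * α))) (Ioi 1) ↔ 1 / 2 < α := by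
    rw [integrableOn_Ioi_rpow_iff one_pos]
    constructor <;> intro h <;> linarith
  rw [← hpow]
  constructor
  · intro h
    refine Integrable.mono' (h.const_mul ((Real.Gamma (1 - α) + 1) ^ 2))
      (by fun_prop) ?_
    filter_upwards [ae_restrict_mem measurableSet_Ioi] with t ht
    have ht1 : (1 : ℝ) ≤ t := le_of_lt ht
    have ht0 : (0 : ℝ) < t := by linarith
    have hΓ : 0 < Real.Gamma (1 - α) := Real.Gamma_pos_of_pos (by linarith)
    have hle := pow_le_pow_left₀ (by positivity) (rpow_neg_mul_le_mittagLeffler_one hα hα1 ht1) 2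
    rw [hsq ht0, inv_pow, inv_mul_le_iff₀ (by positivity)] at hle
    rwa [Real.norm_of_nonneg (by positivity)]
  · intro h
    refine Integrable.mono' (h.const_mul ((Real.Gamma (2 - α))⁻¹ ^ 2))
      hcont.aestronglyMeasurable ?_
    filter_upwards [ae_restrict_mem measurableSet_Ioi] with t ht
    have ht0 : (0 : ℝ) < t := lt_trans one_pos ht
    rw [Real.norm_of_nonneg (by positivity), ← hsq ht0]
    exact pow_le_pow_left₀ (mittagLeffler_one_neg_rpow_nonneg hα hα1 ht0)
      (mittagLeffler_one_le_mul_rpow_neg hα hα1 ht0) 2
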